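/- arXiv:2008.10235 — 7 statements merged into one kernel-verified Lean document; each statement's English description precedes it below -/
import Mathlib

section
/- Let C be a C*-algebra, τ a tracial state on C, and A a closed *-subalgebra of C such that sup{ τ(a) : a ∈ A, 0 ≤ a ≤ 1 } = 1 (that is, the restriction of τ to A is a state). Then every element x ∈ C satisfying x·a = 0 for all a ∈ A has τ(x) = 0. -/
/-- If `x * star a = 0`, then `x` and `a` satisfy the Pythagorean inequality. -/
theorem CStarRing.norm_add_sq_le_of_mul_star_eq_zero {C : Type*} [NonUnitalNormedRing C]
    [StarRing C] [CStarRing C] {x a : C} (h : x * star a = 0) :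
    ‖a + x‖ ^ 2 ≤ ‖a‖ ^ 2 + ‖x‖ ^ 2 := by
  have h' : a * star x = 0 := by simpa using congrArg star h
  have hmul : (a + x) * star (a + x) = a * star a + x * star x := by
    rw [star_add, add_mul, mul_add, mul_add, h, h', add_zero, zero_add]
  calc ‖a + x‖ ^ 2 = ‖a * star a + x * star x‖ := by
        rw [← hmul, CStarRing.norm_self_mul_star, sq]
    _ ≤ ‖a * star a‖ + ‖x * star x‖ := norm_add_le _ _
    _ = ‖a‖ ^ 2 + ‖x‖ ^ 2 := by
        rw [CStarRing.norm_self_mul_star, CStarRing.norm_self_mul_star, sq, sq]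

/-- Let `C` be a (non-unital) C*-algebra, `τ` a tracial state on `C`
(a continuous linear functional of norm one, taking nonnegative real values on positive
elements, and satisfying the trace identity `τ (x * y) = τ (y * x)`), and `A` a closed
*-subalgebra of `C` such that `sup { τ a : a ∈ A, 0 ≤ a, ‖a‖ ≤ 1 } = 1` (i.e. the
restriction of `τ` to `A` is a state).  Then every `x ∈ C` satisfying `x * a = 0` for
all `a ∈ A` has `τ x = 0`. -/
theorem stmt0 {C : Type*} [NonUnitalCStarAlgebra C] [PartialOrder C] [StarOrderedRing C]
    (τ : C →L[ℂ] ℂ) (hτnorm : ‖τ‖ = 1)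
    (hτpos : ∀ a : C, 0 ≤ a → ∃ r : ℝ, 0 ≤ r ∧ τ a = (r : ℂ))
    (hτtr : ∀ x y : C, τ (x * y) = τ (y * x))
    (A : NonUnitalStarSubalgebra ℂ C) (hA : IsClosed (A : Set C))
    (hstate : IsLUB {r : ℝ | ∃ a ∈ A, 0 ≤ a ∧ ‖a‖ ≤ 1 ∧ τ a = (r : ℂ)} 1)
    (x : C) (hx : ∀ a ∈ A, x * a = 0) : τ x = 0 := by
  have key : ∀ s : ℝ, 0 ≤ s →
      (1 + s * ‖τ x‖ ^ 2) ^ 2 ≤ 1 + s ^ 2 * ‖τ x‖ ^ 2 * ‖x‖ ^ 2 := by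
    intro s hs
    have hbound : 1 ≤ √(1 + s ^ 2 * ‖τ x‖ ^ 2 * ‖x‖ ^ 2) - s * ‖τ x‖ ^ 2 := by
      refine hstate.2 ?_
      rintro r ⟨a, haA, ha, ha1, har⟩
      rw [le_sub_iff_add_le]
      set t : ℂ := s * star (τ x) with ht
      have horth : (t • x) * star a = 0 := by
        rw [ha.isSelfAdjoint.star_eq, smul_mul_assoc, hx a haA, smul_zero]
      have hτ : τ (a + t • x) = ((r + s * ‖τ x‖ ^ 2 : ℝ) : ℂ) := by
        rw [map_add, map_smul, har, ht, smul_eq_mul, mul_assoc, Complex.star_def,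
          Complex.conj_mul']
        push_cast
        rfl
      have hnorm : ‖t • x‖ ^ 2 = s ^ 2 * ‖τ x‖ ^ 2 * ‖x‖ ^ 2 := by
        rw [norm_smul, ht, norm_mul, norm_star, Complex.norm_real, mul_pow, mul_pow,
          Real.norm_eq_abs, sq_abs]
      calc r + s * ‖τ x‖ ^ 2 ≤ ‖τ (a + t • x)‖ := by
            rw [hτ, Complex.norm_real]
            exact Real.le_norm_self _
        _ ≤ ‖a + t • x‖ := by simpa [hτnorm] using τ.le_opNorm (a + t • x)
        _ ≤ √(1 + s ^ 2 * ‖τ x‖ ^ 2 * ‖x‖ ^ 2) := by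
            refine Real.le_sqrt_of_sq_le ?_
            rw [← hnorm]
            exact (CStarRing.norm_add_sq_le_of_mul_star_eq_zero horth).trans
              (by gcongr; exact pow_le_one₀ (norm_nonneg a) ha1)
    exact (Real.le_sqrt (by positivity) (by positivity)).1 (by linarith)
  by_contra hne
  have hp : 0 < ‖τ x‖ ^ 2 := by positivity
  set s : ℝ := (‖x‖ ^ 2 + 1)⁻¹
  have hs0 : 0 < s := by positivity
  have hs1 : s * ‖x‖ ^ 2 < 1 := by
    have : s * (‖x‖ ^ 2 + 1) = 1 := inv_mul_cancel₀ (by positivity)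
    linarith
  have hlt : s * ‖τ x‖ ^ 2 * (s * ‖x‖ ^ 2) < s * ‖τ x‖ ^ 2 * 1 := by gcongr
  nlinarith [key s hs0.le, mul_pos hs0 hp, sq_nonneg (s * ‖τ x‖ ^ 2)]
end

section
/- Let B be a C*-algebra and A a closed *-subalgebra of B which has a unit e (a self-adjoint element e ∈ A with e·a = a·e = a for all a ∈ A). If x ∈ A is invertible in A relative to e (there exists y ∈ A with x·y = y·x = e), then x, viewed inside the unitization B~ = Unitization ℂ B, is a norm-limit of invertible elements of B~. -/
/-- If `x` and `y` are mutually inverse relative to an element `e` acting as a unit on them, then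
`x + t • (1 - e)` is invertible for every nonzero scalar `t`. -/
theorem isUnit_add_smul_one_sub {𝕜 R : Type*} [Field 𝕜] [Ring R] [Algebra 𝕜 R] {e x y : R}
    (hex : e * x = x) (hxe : x * e = x) (hey : e * y = y) (hye : y * e = y)
    (hxy : x * y = e) (hyx : y * x = e) {t : 𝕜} (ht : t ≠ 0) :
    IsUnit (x + t • (1 - e)) := by
  have hee : e * e = e := by rw [← hxy, ← mul_assoc, hxy, hex, hxy]
  refine ⟨⟨x + t • (1 - e), y + t⁻¹ • (1 - e), ?_, ?_⟩, rfl⟩ <;>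
    simp [add_mul, mul_add, mul_sub, sub_mul, smul_smul, *]

/-- An element that is invertible relative to an element `e` acting as a unit on it and on its
relative inverse is a limit of invertible elements. -/
theorem mem_closure_isUnit_of_relative_inverse (𝕜 : Type*) {R : Type*} [NontriviallyNormedField 𝕜]
    [Ring R] [Algebra 𝕜 R] [TopologicalSpace R] [ContinuousAdd R] [ContinuousSMul 𝕜 R]
    {e x y : R} (hex : e * x = x) (hxe : x * e = x) (hey : e * y = y) (hye : y * e = y)
    (hxy : x * y = e) (hyx : y * x = e) :
    x ∈ closure {z : R | IsUnit z} := by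
  have hcont : Continuous fun t : 𝕜 => x + t • (1 - e) := by fun_prop
  have hlim : Filter.Tendsto (fun t : 𝕜 => x + t • (1 - e)) (nhdsWithin 0 {0}ᶜ) (nhds x) := by
    simpa using (hcont.tendsto 0).mono_left nhdsWithin_le_nhds
  refine mem_closure_of_tendsto hlim ?_
  filter_upwards [self_mem_nhdsWithin] with t ht
  exact isUnit_add_smul_one_sub hex hxe hey hye hxy hyx ht

/-- Let `B` be a C*-algebra and `A` a closed *-subalgebra of `B` having a unit
`e` (a selfadjoint element acting as a multiplicative identity on `A`).  If `x ∈ A` is invertible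
in `A` relative to `e`, then `x`, viewed inside the unitization `B~ = Unitization ℂ B`, is a
norm-limit of invertible elements of `B~`. -/
theorem stmt1 {B : Type*} [NonUnitalCStarAlgebra B]
    (A : NonUnitalStarSubalgebra ℂ B) (hA : IsClosed (A : Set B))
    (e : B) (he : e ∈ A) (heSA : IsSelfAdjoint e)
    (hunit : ∀ a ∈ A, e * a = a ∧ a * e = a)
    (x : B) (hx : x ∈ A) (hinv : ∃ y ∈ A, x * y = e ∧ y * x = e) :
    (x : Unitization ℂ B) ∈ closure {z : Unitization ℂ B | IsUnit z} := by
  obtain ⟨y, hy, hxy, hyx⟩ := hinv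
  refine mem_closure_isUnit_of_relative_inverse ℂ (e := (e : Unitization ℂ B))
    (y := (y : Unitization ℂ B)) ?_ ?_ ?_ ?_ ?_ ?_ <;>
    simp only [← Unitization.inr_mul, hunit x hx, hunit y hy, hxy, hyx]
end

section
/- Let A be a C*-algebra and (A_n)_{n∈ℕ} a sequence of closed *-subalgebras of A with A_n ⊆ A_{n+1} for all n and with A equal to the closure of ⋃_{n∈ℕ} A_n. If for every n every element of A_n, viewed inside the unitization Unitization ℂ A_n, is a norm-limit of invertible elements of Unitization ℂ A_n, then every element of A, viewed inside Unitization ℂ A, is a norm-limit of invertible elements of Unitization ℂ A. -/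
/-- The functorial extension of a continuous `*`-homomorphism to the unitizations is continuous. -/
theorem Unitization.continuous_starMap {𝕜 A B : Type*} [NontriviallyNormedField 𝕜] [StarRing 𝕜]
    [NonUnitalNormedRing A] [StarRing A] [NormedSpace 𝕜 A] [IsScalarTower 𝕜 A A]
    [SMulCommClass 𝕜 A A] [RegularNormedAlgebra 𝕜 A] [StarModule 𝕜 A]
    [NonUnitalNormedRing B] [StarRing B] [NormedSpace 𝕜 B] [IsScalarTower 𝕜 B B]
    [SMulCommClass 𝕜 B B] [RegularNormedAlgebra 𝕜 B] [StarModule 𝕜 B]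
    {φ : A →⋆ₙₐ[𝕜] B} (hφ : Continuous φ) : Continuous (Unitization.starMap φ) := by
  have starMap_eq : (Unitization.starMap φ : Unitization 𝕜 A → Unitization 𝕜 B) =
      fun x ↦ algebraMap 𝕜 (Unitization 𝕜 B) x.fst + (φ x.snd : Unitization 𝕜 B) := by
    funext x
    induction x
    simp
  rw [starMap_eq]
  fun_prop

/-- Let `A` be a C*-algebra and `(Aₙ)` an increasing sequence of closed
*-subalgebras of `A` whose union is dense in `A`.  If for every `n` every element of `Aₙ`,
viewed inside `Unitization ℂ Aₙ`, is a norm-limit of invertible elements of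
`Unitization ℂ Aₙ`, then every element of `A`, viewed inside `Unitization ℂ A`, is a
norm-limit of invertible elements of `Unitization ℂ A`. -/
theorem stmt2 {A : Type*} [NonUnitalCStarAlgebra A]
    (Asub : ℕ → NonUnitalStarSubalgebra ℂ A)
    (hclosed : ∀ n, IsClosed ((Asub n : Set A)))
    (hmono : ∀ n, Asub n ≤ Asub (n + 1))
    (hdense : closure (⋃ n, (Asub n : Set A)) = Set.univ)
    (hinv : ∀ n, letI := hclosed n;
      ∀ x : (Asub n), (x : Unitization ℂ (Asub n)) ∈
        closure {z : Unitization ℂ (Asub n) | IsUnit z}) :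
    ∀ x : A, (x : Unitization ℂ A) ∈ closure {z : Unitization ℂ A | IsUnit z} := by
  have hsub : (⋃ n, (Asub n : Set A)) ⊆
      (fun x : A ↦ (x : Unitization ℂ A)) ⁻¹' closure {z : Unitization ℂ A | IsUnit z} := by
    refine Set.iUnion_subset fun n a ha ↦ ?_
    have hcont := Unitization.continuous_starMap (φ := NonUnitalStarSubalgebraClass.subtype (Asub n))
      continuous_subtype_val
    have hmaps : Set.MapsTo (Unitization.starMap (NonUnitalStarSubalgebraClass.subtype (Asub n)))
        {z | IsUnit z} {z | IsUnit z} := fun z hz ↦ hz.map _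
    simpa using hmaps.closure hcont (hinv n ⟨a, ha⟩)
  have hcl : IsClosed
      ((fun x : A ↦ (x : Unitization ℂ A)) ⁻¹' closure {z : Unitization ℂ A | IsUnit z}) :=
    isClosed_closure.preimage Unitization.continuous_inr
  intro x
  exact closure_minimal hsub hcl (hdense ▸ Set.mem_univ x)
end

section
/- Let B be a C*-algebra with dense invertibles, i.e. every element of B, viewed inside B~ = Unitization ℂ B, is a norm-limit of invertible elements of B~. Let ω be an ultrafilter on ℕ, let (x_n)_{n∈ℕ} be a bounded sequence in B, and let ε > 0. Then there exist λ ∈ ℂ, a bounded sequence (y_n)_{n∈ℕ} in B, and M > 0 such that the set { n ∈ ℕ : y_n + λ·1 is invertible in B~, ‖(y_n + λ·1)^{-1}‖ ≤ M, and ‖x_n − (y_n + λ·1)‖ < ε } belongs to ω. -/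
open Filter Topology

section CStarAlgebra

variable {A : Type*} [CStarAlgebra A]

/-- In a unital C⋆-algebra, a positive element shifted by `δ > 0` is invertible, and its inverse
has norm at most `δ⁻¹`. -/
lemma exists_unit_eq_add_algebraMap [PartialOrder A] [StarOrderedRing A] {a : A} (ha : 0 ≤ a)
    {δ : ℝ} (hδ : 0 < δ) :
    ∃ b : Aˣ, (b : A) = a + algebraMap ℝ A δ ∧ ‖(↑b⁻¹ : A)‖ ≤ δ⁻¹ := by
  have hpos : ∀ t ∈ spectrum ℝ a, 0 < t + δ := fun t ht ↦
    add_pos_of_nonneg_of_pos (spectrum_nonneg_of_nonneg ha ht) hδ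
  have hcont : ContinuousOn (fun t : ℝ ↦ (t + δ)⁻¹) (spectrum ℝ a) :=
    ContinuousOn.inv₀ (by fun_prop) fun t ht ↦ (hpos t ht).ne'
  have hb : a + algebraMap ℝ A δ = cfc (fun t : ℝ ↦ t + δ) a := by
    rw [cfc_add_const δ (fun t : ℝ ↦ t) a, cfc_id' ℝ a]
  have hright : cfc (fun t : ℝ ↦ t + δ) a * cfc (fun t : ℝ ↦ (t + δ)⁻¹) a = 1 := by
    rw [← cfc_mul _ _ a, ← cfc_one ℝ a]
    exact cfc_congr fun t ht ↦ mul_inv_cancel₀ (hpos t ht).ne'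
  have hleft : cfc (fun t : ℝ ↦ (t + δ)⁻¹) a * cfc (fun t : ℝ ↦ t + δ) a = 1 := by
    rw [← cfc_mul _ _ a, ← cfc_one ℝ a]
    exact cfc_congr fun t ht ↦ inv_mul_cancel₀ (hpos t ht).ne'
  refine ⟨⟨_, _, hright, hleft⟩, hb.symm, norm_cfc_le (by positivity) fun t ht ↦ ?_⟩
  rw [norm_inv, Real.norm_of_nonneg (hpos t ht).le]
  exact inv_anti₀ hδ (by linarith [spectrum_nonneg_of_nonneg ha ht])

/-- Polar decomposition of an invertible element of a unital C⋆-algebra. -/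
lemma IsUnit.exists_mem_unitary_mul_abs [PartialOrder A] [StarOrderedRing A] {z : A}
    (hz : IsUnit z) : ∃ u ∈ unitary A, z = u * CFC.abs z := by
  have hsq : CFC.abs z * CFC.abs z = star z * z := CFC.abs_mul_abs z
  have habs : IsUnit (CFC.abs z) := by
    have h : IsUnit (CFC.abs z * CFC.abs z) := hsq ▸ hz.star.mul hz
    exact ((Commute.refl (CFC.abs z)).isUnit_mul_iff.mp h).1
  have hsa : star (CFC.abs z) = CFC.abs z := (CFC.abs_nonneg z).isSelfAdjoint.star_eq
  obtain ⟨c, hc⟩ := habs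
  rw [← hc] at hsq hsa ⊢
  have hcs : star (↑c⁻¹ : A) = ↑c⁻¹ := by
    rw [← Units.coe_star, star_inv, show star c = c from Units.ext hsa]
  have hu : star (z * ↑c⁻¹) * (z * ↑c⁻¹) = 1 := by
    calc star (z * ↑c⁻¹) * (z * ↑c⁻¹) = ↑c⁻¹ * (star z * z) * ↑c⁻¹ := by
          simp only [star_mul, hcs, mul_assoc]
      _ = 1 := by rw [← hsq]; simp
  have huu : IsUnit (z * ↑c⁻¹) := hz.mul c⁻¹.isUnit
  refine ⟨z * ↑c⁻¹, Unitary.mem_iff.mpr ⟨hu, ?_⟩, by simp⟩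
  exact huu.mul_right_cancel (by rw [mul_assoc, hu, mul_one, one_mul])

/-- An invertible element of a unital C⋆-algebra is within `δ` of an invertible whose inverse has
norm at most `δ⁻¹`. -/
lemma IsUnit.exists_norm_sub_le_norm_inv_le [Nontrivial A] {z : A} (hz : IsUnit z)
    {δ : ℝ} (hδ : 0 < δ) : ∃ w : Aˣ, ‖z - w‖ ≤ δ ∧ ‖(↑w⁻¹ : A)‖ ≤ δ⁻¹ := by
  let _ := CStarAlgebra.spectralOrder A
  have _ := CStarAlgebra.spectralOrderedRing A
  obtain ⟨u, hu, hzu⟩ := hz.exists_mem_unitary_mul_abs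
  obtain ⟨b, hb, hbinv⟩ := exists_unit_eq_add_algebraMap (CFC.abs_nonneg z) hδ
  refine ⟨Unitary.toUnits ⟨u, hu⟩ * b, ?_, ?_⟩
  · have h : z - ↑(Unitary.toUnits ⟨u, hu⟩ * b) = -(u * algebraMap ℝ A δ) := by
      nth_rw 1 [hzu]
      simp [hb, mul_add]
    rw [h, norm_neg, CStarRing.norm_mem_unitary_mul _ hu, norm_algebraMap',
      Real.norm_of_nonneg hδ.le]
  · have h : (↑(Unitary.toUnits ⟨u, hu⟩ * b)⁻¹ : A) = ↑b⁻¹ * star u := by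
      simp [mul_inv_rev, ← Unitary.star_eq_inv]
    rwa [h, CStarRing.norm_mul_mem_unitary _ (Unitary.star_mem hu)]

end CStarAlgebra

/-- A perturbation of size at most `δ / 2` of a unit whose inverse has norm at most `δ⁻¹` is a
unit whose inverse has norm at most `2 * δ⁻¹`. -/
lemma Units.isUnit_and_norm_inverse_le_of_norm_sub_le {R : Type*} [NormedRing R] [CompleteSpace R]
    [Nontrivial R] {δ : ℝ} (hδ : 0 < δ) (w : Rˣ) (hw : ‖(↑w⁻¹ : R)‖ ≤ δ⁻¹) {v : R}
    (hv : ‖v - w‖ ≤ δ / 2) :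
    IsUnit v ∧ ‖Ring.inverse v‖ ≤ 2 * δ⁻¹ := by
  have hlt : ‖v - w‖ < ‖(↑w⁻¹ : R)‖⁻¹ :=
    hv.trans_lt ((half_lt_self hδ).trans_le (le_inv_of_le_inv₀ (Units.norm_pos _) hw))
  obtain ⟨V, rfl⟩ : IsUnit v := (w.ofNearby v hlt).isUnit
  refine ⟨V.isUnit, ?_⟩
  rw [Ring.inverse_unit]
  have hres : (↑V⁻¹ : R) = ↑w⁻¹ - ↑V⁻¹ * (V - w) * ↑w⁻¹ := by
    simp [mul_sub, sub_mul]
  have hprod : ‖(↑V⁻¹ : R) * (V - w) * ↑w⁻¹‖ ≤ ‖(↑V⁻¹ : R)‖ / 2 :=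
    calc ‖(↑V⁻¹ : R) * (V - w) * ↑w⁻¹‖ ≤ ‖(↑V⁻¹ : R)‖ * ‖(V : R) - w‖ * ‖(↑w⁻¹ : R)‖ :=
          norm_mul₃_le
      _ ≤ ‖(↑V⁻¹ : R)‖ * (δ / 2) * δ⁻¹ := by gcongr
      _ = ‖(↑V⁻¹ : R)‖ / 2 := by field_simp
  have hle : ‖(↑V⁻¹ : R)‖ ≤ δ⁻¹ + ‖(↑V⁻¹ : R)‖ / 2 :=
    calc ‖(↑V⁻¹ : R)‖ = ‖(↑w⁻¹ : R) - ↑V⁻¹ * (V - w) * ↑w⁻¹‖ := congrArg _ hres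
      _ ≤ _ := (norm_sub_le _ _).trans (add_le_add hw hprod)
  linarith

lemma Unitization.norm_fst_le {B : Type*} [NonUnitalCStarAlgebra B] (z : Unitization ℂ B) :
    ‖z.fst‖ ≤ ‖z‖ := by
  rw [Unitization.norm_eq_sup]
  exact le_sup_left


open Unitization in
/-- Let `B` be a C*-algebra with dense invertibles (every element of `B`, viewed
inside `B~ = Unitization ℂ B`, is a norm-limit of invertibles of `B~`).  Let `ω` be an ultrafilter
on `ℕ`, `(xₙ)` a bounded sequence in `B`, and `ε > 0`.  Then there exist `λ ∈ ℂ`, a bounded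
sequence `(yₙ)` in `B` and `M > 0` such that the set of `n` for which `yₙ + λ·1` is invertible in
`B~` with `‖(yₙ + λ·1)⁻¹‖ ≤ M` and `‖xₙ - (yₙ + λ·1)‖ < ε` belongs to `ω`. -/
theorem stmt3 {B : Type*} [NonUnitalCStarAlgebra B]
    (hB : ∀ b : B, (b : Unitization ℂ B) ∈ closure {z : Unitization ℂ B | IsUnit z})
    (ω : Ultrafilter ℕ) (x : ℕ → B) (hx : ∃ K : ℝ, ∀ n, ‖x n‖ ≤ K)
    (ε : ℝ) (hε : 0 < ε) :
    ∃ (lam : ℂ) (y : ℕ → B) (M : ℝ), (∃ K : ℝ, ∀ n, ‖y n‖ ≤ K) ∧ 0 < M ∧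
      {n : ℕ | IsUnit ((y n : Unitization ℂ B) + lam • 1) ∧
        ‖Ring.inverse ((y n : Unitization ℂ B) + lam • 1)‖ ≤ M ∧
        ‖(x n : Unitization ℂ B) - ((y n : Unitization ℂ B) + lam • 1)‖ < ε} ∈ ω := by
  obtain ⟨K, hK⟩ := hx
  obtain ⟨δ, hδ, hδε⟩ : ∃ δ : ℝ, 0 < δ ∧ 2 * δ + δ / 2 < ε := ⟨ε / 4, by linarith, by linarith⟩
  have happrox : ∀ n, ∃ w : (Unitization ℂ B)ˣ,
      ‖(x n : Unitization ℂ B) - w‖ ≤ 2 * δ ∧ ‖(↑w⁻¹ : Unitization ℂ B)‖ ≤ δ⁻¹ := by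
    intro n
    obtain ⟨z, hz, hxz⟩ := Metric.mem_closure_iff.mp (hB (x n)) δ hδ
    rw [dist_eq_norm] at hxz
    obtain ⟨w, hzw, hw⟩ := IsUnit.exists_norm_sub_le_norm_inv_le hz hδ
    exact ⟨w, by linarith [norm_sub_le_norm_sub_add_norm_sub (x n : Unitization ℂ B) z w], hw⟩
  choose w hxw hw using happrox
  have hfst : ∀ n, ‖(w n : Unitization ℂ B).fst‖ ≤ 2 * δ := fun n ↦ by
    have h : ((x n : Unitization ℂ B) - w n).fst = -(w n : Unitization ℂ B).fst := by
      simpa using map_sub (fstHom ℂ B) (x n : Unitization ℂ B) (w n)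
    simpa [h] using (Unitization.norm_fst_le _).trans (hxw n)
  have hdecomp : ∀ n, (((w n : Unitization ℂ B).snd : B) : Unitization ℂ B) =
      w n - (w n : Unitization ℂ B).fst • 1 := fun n ↦ by
    rw [eq_sub_iff_add_eq]
    ext <;> simp
  obtain ⟨lam, -, hlam⟩ := (isCompact_closedBall (0 : ℂ) (2 * δ)).ultrafilter_le_nhds
    (ω.map fun n ↦ (w n : Unitization ℂ B).fst)
    (le_principal_iff.mpr <| mem_map.mpr <|
      univ_mem' fun n ↦ mem_closedBall_zero_iff.mpr (hfst n))
  refine ⟨lam, fun n ↦ (w n : Unitization ℂ B).snd, 2 * δ⁻¹, ⟨K + 4 * δ, fun n ↦ ?_⟩,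
    by positivity, ?_⟩
  · rw [← norm_inr (𝕜 := ℂ), hdecomp]
    have hwn := norm_sub_norm_le (w n : Unitization ℂ B) (x n)
    rw [norm_sub_rev, norm_inr] at hwn
    have hsub := norm_sub_le (w n : Unitization ℂ B) ((w n : Unitization ℂ B).fst • 1)
    rw [norm_smul, norm_one, mul_one] at hsub
    linarith [hK n, hxw n, hfst n]
  · have hclose := hlam (Metric.closedBall_mem_nhds lam (half_pos hδ))
    filter_upwards [hclose] with n hn
    rw [Set.mem_preimage, mem_closedBall_iff_norm'] at hn
    have hdist : ‖((w n : Unitization ℂ B).snd : Unitization ℂ B) + lam • 1 - w n‖ ≤ δ / 2 := by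
      rw [hdecomp, show (w n : Unitization ℂ B) - (w n : Unitization ℂ B).fst • 1 + lam • 1 - w n =
        (lam - (w n : Unitization ℂ B).fst) • 1 by rw [sub_smul]; abel, norm_smul, norm_one,
        mul_one]
      exact hn
    obtain ⟨hunit, hinv⟩ := (w n).isUnit_and_norm_inverse_le_of_norm_sub_le hδ (hw n) hdist
    refine ⟨hunit, hinv, ?_⟩
    have htri := norm_sub_le_norm_sub_add_norm_sub (x n : Unitization ℂ B) (w n)
      (((w n : Unitization ℂ B).snd : Unitization ℂ B) + lam • 1)
    rw [norm_sub_rev (w n : Unitization ℂ B)] at htri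
    linarith [hxw n]
end

section
/- Let C be a C*-algebra with dense invertibles, i.e. every element of C, viewed inside Unitization ℂ C, is a norm-limit of invertible elements of Unitization ℂ C. Then for every separable subset S of C there exists a closed *-subalgebra A of C such that A is separable (as a topological space), S ⊆ A, and A has dense invertibles, i.e. every element of A, viewed inside Unitization ℂ A, is a norm-limit of invertible elements of Unitization ℂ A. -/
open TopologicalSpace Filter Topology

/-- A countable set is contained in a countable set that is closed under a given countable family
of binary operations. -/
theorem Set.Countable.exists_countable_superset_closed {X : Type*} {T : Set X} (hT : T.Countable)
    {F : Set (X → X → X)} (hF : F.Countable) :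
    ∃ D : Set X, D.Countable ∧ T ⊆ D ∧ ∀ f ∈ F, ∀ x ∈ D, ∀ y ∈ D, f x y ∈ D := by
  let step : Set X → Set X := fun E => E ∪ ⋃ f ∈ F, Set.image2 f E E
  have hmono : Monotone fun k => step^[k] T :=
    monotone_nat_of_le_succ fun k => by
      rw [Function.iterate_succ_apply']
      exact Set.subset_union_left
  refine ⟨⋃ k, step^[k] T, Set.countable_iUnion fun k => ?_,
    Set.subset_iUnion (fun k => step^[k] T) 0, ?_⟩
  · induction k with
    | zero => exact hT
    | succ k ih =>
      rw [Function.iterate_succ_apply']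
      exact ih.union (hF.biUnion fun f _ => ih.image2 ih f)
  · intro f hf x hx y hy
    obtain ⟨i, hi⟩ := Set.mem_iUnion.1 hx
    obtain ⟨j, hj⟩ := Set.mem_iUnion.1 hy
    refine Set.mem_iUnion.2 ⟨max i j + 1, ?_⟩
    rw [Function.iterate_succ_apply']
    exact Or.inr (Set.mem_biUnion hf (Set.mem_image2_of_mem
      (hmono (le_max_left i j) hi) (hmono (le_max_right i j) hj)))

/-- An element of the unitization of a subalgebra is invertible as soon as it is invertible in the
unitization of the ambient algebra and the non-scalar part of its inverse lies in the subalgebra. -/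
theorem NonUnitalStarSubalgebra.isUnit_unitization_mk {R C : Type*} [CommRing R] [StarRing R]
    [NonUnitalRing C] [StarRing C] [Module R C] [IsScalarTower R C C] [SMulCommClass R C C]
    [StarModule R C] (A : NonUnitalStarSubalgebra R C) (u : (Unitization R C)ˣ)
    (h : (u : Unitization R C).snd ∈ A) (h' : (↑u⁻¹ : Unitization R C).snd ∈ A) :
    IsUnit (Unitization.inl (u : Unitization R C).fst +
      Unitization.inr (⟨(u : Unitization R C).snd, h⟩ : A) : Unitization R A) := by
  let φ : Unitization R A →⋆ₐ[R] Unitization R C :=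
    Unitization.starMap (NonUnitalStarSubalgebraClass.subtype A)
  have hφ : Function.Injective φ := Unitization.starMap_injective Subtype.val_injective
  have key : ∀ (z : Unitization R C) (hz : z.snd ∈ A),
      φ (Unitization.inl z.fst + Unitization.inr (⟨z.snd, hz⟩ : A)) = z := by
    intro z hz
    rw [map_add, Unitization.starMap_inl, Unitization.starMap_inr]
    exact Unitization.inl_fst_add_inr_snd_eq z
  exact ⟨⟨_, Unitization.inl (↑u⁻¹ : Unitization R C).fst + Unitization.inr ⟨_, h'⟩,
    hφ (by rw [map_mul, key, key, map_one, Units.mul_inv]),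
    hφ (by rw [map_mul, key, key, map_one, Units.inv_mul])⟩, rfl⟩

/-- The closure of a set closed under the ring operations, the star, and multiplication by a dense
set of scalars is a star subalgebra. -/
def NonUnitalStarSubalgebra.ofClosure {R C : Type*} [CommSemiring R] [TopologicalSpace R]
    [NonUnitalSemiring C] [StarRing C] [Module R C] [TopologicalSpace C] [IsTopologicalSemiring C]
    [ContinuousStar C] [ContinuousSMul R C] (D : Set C) (K : Set R) (hK : Dense K)
    (hzero : (0 : C) ∈ D) (hadd : ∀ x ∈ D, ∀ y ∈ D, x + y ∈ D) (hmul : ∀ x ∈ D, ∀ y ∈ D, x * y ∈ D)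
    (hstar : ∀ x ∈ D, star x ∈ D) (hsmul : ∀ c ∈ K, ∀ x ∈ D, c • x ∈ D) :
    NonUnitalStarSubalgebra R C where
  carrier := closure D
  zero_mem' := subset_closure hzero
  add_mem' hx hy := map_mem_closure₂ continuous_add hx hy hadd
  mul_mem' hx hy := map_mem_closure₂ continuous_mul hx hy hmul
  star_mem' hx := map_mem_closure continuous_star hx hstar
  smul_mem' c _ hx := map_mem_closure₂ continuous_smul (hK c) hx hsmul

/-- Let `C` be a C*-algebra with dense invertibles.  Then every separable
subset `S` of `C` is contained in a closed separable *-subalgebra `A` of `C` which again has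
dense invertibles (every element of `A`, viewed inside `Unitization ℂ A`, is a norm-limit of
invertible elements of `Unitization ℂ A`). -/
theorem stmt4 {C : Type*} [NonUnitalCStarAlgebra C]
    (hC : ∀ x : C, (x : Unitization ℂ C) ∈ closure {z : Unitization ℂ C | IsUnit z})
    (S : Set C) (hS : TopologicalSpace.IsSeparable S) :
    ∃ A : NonUnitalStarSubalgebra ℂ C, ∃ hA : IsClosed (A : Set C),
      TopologicalSpace.SeparableSpace A ∧ S ⊆ (A : Set C) ∧
      (letI := hA;
        ∀ x : A, (x : Unitization ℂ A) ∈ closure {z : Unitization ℂ A | IsUnit z}) := by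
  have hu : ∀ x : C, ∃ u : ℕ → (Unitization ℂ C)ˣ,
      Tendsto (fun n => (u n : Unitization ℂ C)) atTop (𝓝 (x : Unitization ℂ C)) := by
    intro x
    obtain ⟨z, hz, hlim⟩ := mem_closure_iff_seq_limit.1 (hC x)
    choose u hu using hz
    exact ⟨u, by simpa only [hu] using hlim⟩
  choose u hu using hu
  obtain ⟨T, hT, hST⟩ := hS
  let ops : Set (C → C → C) :=
    {fun x y => x + y, fun x y => x * y, fun x _ => star x} ∪
    (Set.range fun (k : ℕ) (x _ : C) => denseSeq ℂ k • x) ∪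
    (Set.range fun (n : ℕ) (x _ : C) => (u x n : Unitization ℂ C).snd) ∪
    (Set.range fun (n : ℕ) (x _ : C) => (↑(u x n)⁻¹ : Unitization ℂ C).snd)
  have hops : ops.Countable :=
    (((Set.toFinite _).countable.union (Set.countable_range _)).union
      (Set.countable_range _)).union (Set.countable_range _)
  obtain ⟨D, hD, hTD, hclosed⟩ := (hT.insert 0).exists_countable_superset_closed hops
  let A : NonUnitalStarSubalgebra ℂ C :=
    .ofClosure D (Set.range (denseSeq ℂ)) (denseRange_denseSeq ℂ)
      (hTD (Set.mem_insert _ _))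
      (hclosed _ (by simp [ops]))
      (hclosed _ (by simp [ops]))
      (fun x hx => hclosed (fun x _ => star x) (by simp [ops]) x hx x hx)
      (by
        rintro _ ⟨k, rfl⟩ x hx
        exact hclosed (fun x _ => denseSeq ℂ k • x) (by simp [ops]) x hx x hx)
  have hDA : D ⊆ A := subset_closure
  have hsnd : ∀ x ∈ D, ∀ n, (u x n : Unitization ℂ C).snd ∈ A := fun x hx n =>
    hDA (hclosed (fun x _ => (u x n : Unitization ℂ C).snd) (by simp [ops]) x hx x hx)
  have hsnd_inv : ∀ x ∈ D, ∀ n, (↑(u x n)⁻¹ : Unitization ℂ C).snd ∈ A := fun x hx n =>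
    hDA (hclosed (fun x _ => (↑(u x n)⁻¹ : Unitization ℂ C).snd) (by simp [ops]) x hx x hx)
  refine ⟨A, isClosed_closure, hD.isSeparable.closure.separableSpace,
    hST.trans (closure_mono ((Set.subset_insert _ _).trans hTD)), ?_⟩
  have hdense : Dense ((↑) ⁻¹' D : Set A) := by
    intro x
    rw [closure_subtype, Set.image_preimage_eq_of_subset (by simpa using hDA)]
    exact x.2
  have hcont : Continuous fun p : ℂ × A =>
      (Unitization.inl p.1 + Unitization.inr p.2 : Unitization ℂ A) := by
    refine (Unitization.uniformEquivProd (𝕜 := ℂ) (A := A)).symm.continuous.congr fun p => ?_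
    exact (Unitization.inl_fst_add_inr_snd_eq (Unitization.uniformEquivProd.symm p)).symm
  have hinr : Continuous fun a : A => (a : Unitization ℂ A) := by
    simpa [Function.comp_def] using hcont.comp (Continuous.prodMk_right (0 : ℂ))
  intro x
  refine closure_minimal (s := ((↑) ⁻¹' D : Set A)) ?_
    (isClosed_closure.preimage hinr) (hdense x)
  intro y hy
  have hfst : Tendsto (fun n => (u y n : Unitization ℂ C).fst) atTop (𝓝 0) :=
    (Unitization.continuous_fst.tendsto _).comp (hu y)
  have hsnd_lim : Tendsto (fun n => (⟨_, hsnd y hy n⟩ : A)) atTop (𝓝 y) :=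
    tendsto_subtype_rng.2 ((Unitization.continuous_snd.tendsto _).comp (hu y))
  have hlim := (hcont.tendsto (0, y)).comp (hfst.prodMk_nhds hsnd_lim)
  simp only [Unitization.inl_zero, zero_add] at hlim
  exact mem_closure_of_tendsto hlim (Eventually.of_forall fun n =>
    A.isUnit_unitization_mk (u y n) (hsnd y hy n) (hsnd_inv y hy n))
end

section
/- Let A be a C*-algebra with dense invertibles, i.e. every element of A, viewed inside A~ = Unitization ℂ A, is a norm-limit of invertible elements of A~. Let a and b be positive elements of A. Then a is Cuntz smaller than b (there exists a sequence (x_n) in A with ‖x_n* b x_n − a‖ → 0) if and only if for every ε > 0 there exists a unitary element u of A~ such that u·(a − ε)_+·u* (an element of A, since A is an ideal of A~) belongs to the hereditary C*-subalgebra closure{ b·y·b : y ∈ A } of A. -/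
/-- The function `t ↦ max(t, s)^(-1/2)`, a truncation of `t ↦ t^(-1/2)`. -/
noncomputable def truncInvSqrt (s t : ℝ) : ℝ := (√(max t s))⁻¹

section truncInvSqrt

theorem continuous_truncInvSqrt {s : ℝ} (hs : 0 < s) : Continuous (truncInvSqrt s) := by
  unfold truncInvSqrt
  refine Continuous.inv₀ (by fun_prop) fun t => ?_
  exact (Real.sqrt_pos.mpr (lt_max_of_lt_right hs)).ne'

theorem mul_truncInvSqrt_sq {s t : ℝ} (hs : 0 < s) :
    t * (truncInvSqrt s t * truncInvSqrt s t) = t / max t s := by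
  have : 0 ≤ max t s := (lt_max_of_lt_right hs).le
  rw [truncInvSqrt, ← mul_inv, Real.mul_self_sqrt this, div_eq_mul_inv]

theorem mul_truncInvSqrt_sq_mem {s t : ℝ} (hs : 0 < s) (ht : 0 ≤ t) :
    t * (truncInvSqrt s t * truncInvSqrt s t) ∈ Set.Icc 0 1 := by
  have : 0 < max t s := lt_max_of_lt_right hs
  rw [mul_truncInvSqrt_sq hs]
  exact ⟨by positivity, (div_le_one this).mpr (le_max_left _ _)⟩

theorem mul_one_sub_truncInvSqrt_sq_le {s t : ℝ} (hs : 0 < s) (ht : 0 ≤ t) :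
    t * (1 - t * (truncInvSqrt s t * truncInvSqrt s t)) ≤ s := by
  rw [mul_truncInvSqrt_sq hs]
  rcases le_total s t with h | h
  · rw [max_eq_left h, div_self (hs.trans_le h).ne']
    linarith
  · have : 0 ≤ t / max t s := by positivity
    nlinarith

theorem truncInvSqrt_mul_mem {s t : ℝ} (hs : 0 < s) (ht : 0 ≤ t) :
    truncInvSqrt s t * t ∈ Set.Icc (√t - √s) √t := by
  have hmax : 0 < √(max t s) := Real.sqrt_pos.mpr (lt_max_of_lt_right hs)
  rw [truncInvSqrt, Set.mem_Icc, inv_mul_le_iff₀ hmax]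
  constructor
  · rcases le_total s t with h | h
    · have h0 : 0 < √t := Real.sqrt_pos.mpr (hs.trans_le h)
      rw [max_eq_left h]
      nth_rewrite 3 [← Real.mul_self_sqrt ht]
      rw [inv_mul_cancel_left₀ h0.ne']
      linarith [Real.sqrt_nonneg s]
    · have : 0 ≤ (√(max t s))⁻¹ * t := by positivity
      linarith [Real.sqrt_le_sqrt h]
  · nth_rewrite 1 [← Real.mul_self_sqrt ht]
    gcongr
    exact le_max_left _ _

end truncInvSqrt

section ramp

/-- The piecewise linear function that is `0` up to `s` and `1` from `s + δ` on. -/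
noncomputable def ramp (δ s t : ℝ) : ℝ := min 1 (max 0 ((t - s) / δ))

theorem continuous_ramp (δ s : ℝ) : Continuous (ramp δ s) := by
  unfold ramp
  fun_prop

theorem ramp_nonneg (δ s t : ℝ) : 0 ≤ ramp δ s t := le_min zero_le_one (le_max_left _ _)

theorem ramp_of_le {δ s t : ℝ} (hδ : 0 < δ) (h : t ≤ s) : ramp δ s t = 0 := by
  have : (t - s) / δ ≤ 0 := div_nonpos_of_nonpos_of_nonneg (sub_nonpos.mpr h) hδ.le
  rw [ramp, max_eq_left this, min_eq_right zero_le_one]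

theorem ramp_of_ge {δ s t : ℝ} (hδ : 0 < δ) (h : s + δ ≤ t) : ramp δ s t = 1 := by
  have : 1 ≤ (t - s) / δ := (one_le_div hδ).mpr (by linarith)
  rw [ramp, min_eq_left (le_max_of_le_right this)]

theorem cfc_ramp_mul_cfc {B : Type*} [CStarAlgebra B] {δ s : ℝ} (hδ : 0 < δ) (a : B)
    {f : ℝ → ℝ} (hf : Continuous f) (hf0 : ∀ t ≤ s + δ, f t = 0) :
    cfc (ramp δ s) a * cfc f a = cfc f a := by
  have := continuous_ramp δ s
  rw [← cfc_mul _ _ a (by fun_prop) (by fun_prop)]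
  congr 1
  ext t
  rcases le_total t (s + δ) with h | h
  · rw [hf0 t h, mul_zero]
  · rw [ramp_of_ge hδ h, one_mul]

end ramp

section CStarAlgebra

open Filter Topology

variable {B : Type*} [CStarAlgebra B] [PartialOrder B] [StarOrderedRing B]

/-- The polar part of an invertible `y` agrees with `y` on everything that `star y * y` fixes. -/
theorem exists_unitary_mul_eq_of_isUnit {y g : B} (hy : IsUnit y) (hg : star y * y * g = g) :
    ∃ u ∈ unitary B, u * g = y * g := by
  have hP : 0 ≤ star y * y := star_mul_self_nonneg y
  have hqq : CFC.sqrt (star y * y) * CFC.sqrt (star y * y) = star y * y :=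
    CFC.sqrt_mul_sqrt_self _
  have hq0 : 0 ≤ CFC.sqrt (star y * y) := CFC.sqrt_nonneg _
  generalize CFC.sqrt (star y * y) = q at hqq hq0
  have hqs : star q = q := (IsSelfAdjoint.of_nonneg hq0).star_eq
  have hqu : IsUnit q := by
    have : IsUnit (q * q) := hqq ▸ hy.star.mul hy
    exact ((Commute.refl q).isUnit_mul_iff.mp this).1
  have hq1 : IsUnit (q + 1) :=
    CStarAlgebra.isUnit_of_le 1 (le_add_of_nonneg_left hq0)
  have hqg : q * g = g := by
    have : (q + 1) * (q * g - g) = 0 := by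
      have : (q + 1) * (q * g - g) = q * q * g - g := by noncomm_ring
      rw [this, hqq, hg, sub_self]
    exact sub_eq_zero.mp (hq1.mul_right_eq_zero.mp this)
  obtain ⟨q, rfl⟩ := hqu
  have hqi : star (↑q⁻¹ : B) = ↑q⁻¹ := by
    have : star q = q := Units.ext hqs
    rw [← Units.coe_star, star_inv, this]
  refine ⟨y * ↑q⁻¹, ?_, ?_⟩
  · have h1 : star (y * (↑q⁻¹ : B)) * (y * ↑q⁻¹) = 1 := by
      rw [star_mul, hqi, mul_assoc, ← mul_assoc (star y), ← hqq, mul_assoc (q : B), Units.mul_inv,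
        mul_one, Units.inv_mul]
    refine Unitary.mem_iff.mpr ⟨h1, ?_⟩
    have hu : IsUnit (y * (↑q⁻¹ : B)) := hy.mul q⁻¹.isUnit
    refine hu.mul_right_cancel ?_
    rw [mul_assoc, h1, mul_one, one_mul]
  · rw [mul_assoc]
    congr 1
    nth_rewrite 1 [← hqg]
    rw [Units.inv_mul_cancel_left]

/-- If `z` is a limit of invertibles and acts isometrically on the support of `e`, where
`g ≪ f ≪ e`, then `z` agrees with some unitary on `g`. -/
theorem exists_unitary_mul_eq_of_mem_closure {z e f g : B}
    (hz : z ∈ closure {w : B | IsUnit w}) (hze : star z * z * e = e)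
    (hf : IsSelfAdjoint f) (hg : IsSelfAdjoint g) (he : IsSelfAdjoint e)
    (hef : e * f = f) (hfg : f * g = g) :
    ∃ u ∈ unitary B, u * g = z * g := by
  have hgf : g * f = g := by simpa [hf.star_eq, hg.star_eq] using congrArg star hfg
  have hzf : star z * z * f = f := by rw [← hef, ← mul_assoc, hze]
  have hge : e * g = g := by rw [← hfg, ← mul_assoc, hef]
  have hge' : g * e = g := by simpa [he.star_eq, hg.star_eq] using congrArg star hge
  obtain ⟨R, hR, hzR⟩ := Metric.mem_closure_iff.mp hz (‖z‖ + 1)⁻¹ (by positivity)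
  have hN : IsUnit (1 - (z - R) * star z) := by
    apply isUnit_one_sub_of_norm_lt_one
    rw [dist_eq_norm] at hzR
    calc ‖(z - R) * star z‖ ≤ ‖z - R‖ * ‖z‖ := by simpa using norm_mul_le (z - R) (star z)
      _ ≤ (‖z‖ + 1)⁻¹ * ‖z‖ := by gcongr
      _ < 1 := by
        rw [inv_mul_lt_iff₀ (by positivity)]
        linarith
  obtain ⟨y, hy, hye⟩ : ∃ y : B, IsUnit y ∧ y * e = z * e := by
    obtain ⟨N, hN⟩ := hN
    refine ⟨↑N⁻¹ * R, N⁻¹.isUnit.mul hR, ?_⟩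
    rw [mul_assoc, Units.inv_mul_eq_iff_eq_mul, hN]
    calc R * e = z * e - z * e + R * e := by noncomm_ring
      _ = z * e - (z - R) * (star z * z * e) := by rw [hze]; noncomm_ring
      _ = _ := by noncomm_ring
  have hyf : y * f = z * f := by rw [← hef, ← mul_assoc, hye, mul_assoc]
  have hyg : y * g = z * g := by rw [← hfg, ← mul_assoc, hyf, mul_assoc]
  have hef' : (1 - e) * f = 0 := by rw [sub_mul, hef, one_mul, sub_self]
  have heg' : (1 - e) * g = 0 := by rw [sub_mul, hge, one_mul, sub_self]
  set Q := f * star z * y * (1 - e) with hQ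
  have hQQ : Q * Q = 0 := by
    have : Q * Q = f * star z * y * ((1 - e) * f) * star z * y * (1 - e) := by
      rw [hQ]; noncomm_ring
    rw [this, hef']; simp
  have hQg : Q * g = 0 := by rw [hQ, mul_assoc, heg', mul_zero]
  have hQu : IsUnit (1 - Q) :=
    ⟨⟨1 - Q, 1 + Q, by
      rw [show (1 - Q) * (1 + Q) = 1 - Q * Q by noncomm_ring, hQQ, sub_zero], by
      rw [show (1 + Q) * (1 - Q) = 1 - Q * Q by noncomm_ring, hQQ, sub_zero]⟩, rfl⟩
  have hy'g : y * (1 - Q) * g = z * g := by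
    rw [mul_assoc, sub_mul, hQg, one_mul, sub_zero, hyg]
  have hgy' : g * star z * (y * (1 - Q)) = g := by
    have h1 : g * star z * y * Q = g * star z * y * (1 - e) := by
      calc g * star z * y * Q = g * star z * (y * f) * star z * y * (1 - e) := by
            rw [hQ]; noncomm_ring
        _ = g * (star z * z * f) * star z * y * (1 - e) := by rw [hyf]; noncomm_ring
        _ = _ := by rw [hzf, hgf]
    calc g * star z * (y * (1 - Q)) = g * star z * y - g * star z * y * Q := by noncomm_ring
      _ = g * star z * (y * e) := by rw [h1]; noncomm_ring
      _ = g * (star z * z * e) := by rw [hye]; noncomm_ring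
      _ = g := by rw [hze, hge']
  obtain ⟨u, hu, hug⟩ := exists_unitary_mul_eq_of_isUnit (hy.mul hQu) (g := g) (by
    have := congrArg star hgy'
    rw [star_mul, star_mul g, star_star, hg.star_eq] at this
    rw [mul_assoc, hy'g, this])
  exact ⟨u, hu, hug.trans hy'g⟩

/-- If `d² ≤ c`, then `‖d h(c) d‖ ≤ sup t h(t)`, the supremum being over the spectrum of `c`. -/
theorem norm_mul_cfc_mul_le {d c : B} (hd : IsSelfAdjoint d) (hdc : d * d ≤ c) {h : ℝ → ℝ}
    (hh : Continuous h) (h0 : ∀ t, 0 ≤ t → 0 ≤ h t) {M : ℝ} (hM0 : 0 ≤ M)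
    (hM : ∀ t, 0 ≤ t → t * h t ≤ M) : ‖d * cfc h c * d‖ ≤ M := by
  have hc : 0 ≤ c := by
    refine le_trans ?_ hdc
    simpa [hd.star_eq] using star_mul_self_nonneg d
  have hsp : ∀ t ∈ spectrum ℝ c, 0 ≤ t := fun t ht => spectrum_nonneg_of_nonneg hc ht
  set σ := cfc (fun t => √(h t)) c with hσ
  have hσs : IsSelfAdjoint σ := cfc_predicate _ c
  have hσσ : σ * σ = cfc h c := by
    rw [hσ, ← cfc_mul _ _ c (by fun_prop) (by fun_prop)]
    exact cfc_congr fun t ht => Real.mul_self_sqrt (h0 t (hsp t ht))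
  have hσc : σ * c * σ = cfc (fun t => √(h t) * t * √(h t)) c := by
    rw [cfc_mul _ _ c (by fun_prop) (by fun_prop), cfc_mul _ _ c (by fun_prop) (by fun_prop),
      cfc_id' ℝ c]
  calc ‖d * cfc h c * d‖ = ‖star (σ * d) * (σ * d)‖ := by
        rw [star_mul, hd.star_eq, hσs.star_eq, ← hσσ]; congr 1; noncomm_ring
    _ = ‖(σ * d) * star (σ * d)‖ := by
        rw [CStarRing.norm_star_mul_self, CStarRing.norm_self_mul_star]
    _ = ‖σ * (d * d) * σ‖ := by
        rw [star_mul, hd.star_eq, hσs.star_eq]; congr 1; noncomm_ring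
    _ ≤ ‖σ * c * σ‖ := by
        apply CStarAlgebra.norm_le_norm_of_nonneg_of_le
        · have := star_mul_self_nonneg (d * σ)
          rw [star_mul, hd.star_eq, hσs.star_eq] at this
          convert this using 1
          noncomm_ring
        · simpa [hσs.star_eq] using star_left_conjugate_le_conjugate hdc σ
    _ ≤ M := by
        rw [hσc]
        refine norm_cfc_le hM0 fun t ht => ?_
        have h1 := h0 t (hsp t ht)
        have : √(h t) * t * √(h t) = t * h t := by
          rw [mul_comm _ t, mul_assoc, Real.mul_self_sqrt h1]
        rw [this, Real.norm_of_nonneg (mul_nonneg (hsp t ht) h1)]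
        exact hM t (hsp t ht)

/-- A positive element below `star T * T` is of the form `star z * z` with `z` in the closed right
ideal generated by `T`. -/
theorem exists_star_mul_self_eq_of_le {m T : B} (hm : 0 ≤ m) (hmT : m ≤ star T * T) :
    ∃ z ∈ closure (Set.range fun r => T * r), star z * z = m := by
  obtain ⟨d, hd, hdd⟩ : ∃ d : B, IsSelfAdjoint d ∧ d * d = m :=
    ⟨CFC.sqrt m, .of_nonneg (CFC.sqrt_nonneg m), CFC.sqrt_mul_sqrt_self m⟩
  set c := star T * T with hc
  have hc0 : 0 ≤ c := star_mul_self_nonneg T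
  have hdc : d * d ≤ c := hdd ▸ hmT
  let s : ℕ → ℝ := fun n => 1 / ((n : ℝ) + 1)
  have hs : ∀ n, 0 < s n := fun n => by positivity
  have hs0 : Tendsto s atTop (𝓝 0) := tendsto_one_div_add_atTop_nhds_zero_nat
  have hcont : ∀ n, Continuous (truncInvSqrt (s n)) := fun n => continuous_truncInvSqrt (hs n)
  let z : ℕ → B := fun n => T * (cfc (truncInvSqrt (s n)) c * d)
  have key : ∀ {f : ℝ → ℝ}, Continuous f →
      star (T * (cfc f c * d)) * (T * (cfc f c * d)) = d * cfc (fun t => t * (f t * f t)) c * d := by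
    intro f hf
    have hfs : star (cfc f c) = cfc f c := (cfc_predicate f c : IsSelfAdjoint _).star_eq
    have hcf : c * (cfc f c * cfc f c) = cfc f c * c * cfc f c := by
      have : Commute (cfc f c) c := (Commute.refl c).cfc_real f
      rw [← mul_assoc, this.eq]
    rw [cfc_mul _ _ c (by fun_prop) (by fun_prop), cfc_mul _ _ c (by fun_prop) (by fun_prop),
      cfc_id' ℝ c, hcf, star_mul, star_mul, hfs, hd.star_eq, hc]
    noncomm_ring
  have hcauchy : CauchySeq z := by
    refine cauchySeq_of_le_tendsto_0 (fun n => √(s n)) (fun n k N hn hk => ?_)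
      (by simpa using hs0.sqrt)
    have hsn : √(s n) ≤ √(s N) := Real.sqrt_le_sqrt (Nat.one_div_le_one_div hn)
    have hsk : √(s k) ≤ √(s N) := Real.sqrt_le_sqrt (Nat.one_div_le_one_div hk)
    have hcn := hcont n
    have hck := hcont k
    have hdiff : z n - z k =
        T * (cfc (fun t => truncInvSqrt (s n) t - truncInvSqrt (s k) t) c * d) := by
      rw [cfc_sub _ _ c (by fun_prop) (by fun_prop)]
      simp only [z]
      noncomm_ring
    rw [dist_eq_norm, ← sq_le_sq₀ (norm_nonneg _) (Real.sqrt_nonneg _), sq, sq,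
      ← CStarRing.norm_star_mul_self, hdiff, key (by fun_prop)]
    refine norm_mul_cfc_mul_le hd hdc (by fun_prop)
      (fun t ht => mul_nonneg ht (mul_self_nonneg _)) (by positivity) fun t ht => ?_
    have h1 := truncInvSqrt_mul_mem (hs n) ht
    have h2 := truncInvSqrt_mul_mem (hs k) ht
    have h3 : |truncInvSqrt (s n) t * t - truncInvSqrt (s k) t * t| ≤ √(s N) := by
      rw [abs_le]
      constructor <;> linarith [h1.1, h1.2, h2.1, h2.2]
    calc _ = |truncInvSqrt (s n) t * t - truncInvSqrt (s k) t * t| *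
          |truncInvSqrt (s n) t * t - truncInvSqrt (s k) t * t| := by rw [abs_mul_abs_self]; ring
      _ ≤ _ := by gcongr
  obtain ⟨z₀, hz₀⟩ := cauchySeq_tendsto_of_complete hcauchy
  refine ⟨z₀, mem_closure_of_tendsto hz₀ (Eventually.of_forall fun n => ⟨_, rfl⟩), ?_⟩
  refine tendsto_nhds_unique (hz₀.star.mul hz₀) ?_
  rw [tendsto_iff_norm_sub_tendsto_zero]
  refine squeeze_zero (fun _ => norm_nonneg _) (fun n => ?_) hs0
  have hcn := hcont n
  have : m - star (z n) * z n =
      d * cfc (fun t => 1 - t * (truncInvSqrt (s n) t * truncInvSqrt (s n) t)) c * d := by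
    rw [key hcn, cfc_sub _ _ c (by fun_prop) (by fun_prop), cfc_const_one ℝ c, ← hdd]
    noncomm_ring
  rw [norm_sub_rev, this]
  exact norm_mul_cfc_mul_le hd hdc (by fun_prop)
    (fun t ht => sub_nonneg.mpr (mul_truncInvSqrt_sq_mem (hs n) ht).2) (hs n).le
    fun t ht => mul_one_sub_truncInvSqrt_sq_le (hs n) ht

theorem cfc_sqrt_mul_mul_mem_closure {b : B} (hb : 0 ≤ b) (y : B) :
    cfc Real.sqrt b * y * cfc Real.sqrt b ∈ closure {w | ∃ r s : B, w = b * (r * y * s) * b} := by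
  let s : ℕ → ℝ := fun n => 1 / ((n : ℝ) + 1)
  have hs : ∀ n, 0 < s n := fun n => by positivity
  have hs0 : Tendsto s atTop (𝓝 0) := tendsto_one_div_add_atTop_nhds_zero_nat
  have hlim : Tendsto (fun n => cfc (truncInvSqrt (s n)) b * b) atTop (𝓝 (cfc Real.sqrt b)) := by
    rw [tendsto_iff_norm_sub_tendsto_zero]
    refine squeeze_zero (fun _ => norm_nonneg _) (fun n => ?_)
      (by simpa using hs0.sqrt : Tendsto (fun n => √(s n)) atTop (𝓝 0))
    have hcn := continuous_truncInvSqrt (hs n)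
    have : cfc (truncInvSqrt (s n)) b * b - cfc Real.sqrt b =
        cfc (fun t => truncInvSqrt (s n) t * t - √t) b := by
      rw [cfc_sub _ _ b (by fun_prop) (by fun_prop), cfc_mul _ _ b (by fun_prop) (by fun_prop),
        cfc_id' ℝ b]
    rw [this]
    refine norm_cfc_le (Real.sqrt_nonneg _) fun t ht => ?_
    have h1 := truncInvSqrt_mul_mem (hs n) (spectrum_nonneg_of_nonneg hb ht)
    rw [Real.norm_eq_abs, abs_le]
    constructor <;> linarith [h1.1, h1.2, Real.sqrt_nonneg (s n)]
  have hcomm : ∀ n, cfc (truncInvSqrt (s n)) b * b = b * cfc (truncInvSqrt (s n)) b :=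
    fun n => ((Commute.refl b).cfc_real _).eq
  refine mem_closure_of_tendsto ((hlim.mul_const y).mul hlim) (Eventually.of_forall fun n => ?_)
  refine ⟨cfc (truncInvSqrt (s n)) b, cfc (truncInvSqrt (s n)) b, ?_⟩
  nth_rewrite 1 [hcomm n]
  noncomm_ring

/-- If `star x * b * x` is close to `a` and the ideal generated by `x` consists of limits of
invertibles, then `(a - ε)₊` is unitarily conjugate to an element of the hereditary subalgebra
generated by `b`. -/
theorem exists_unitary_conj_mem_closure {a b x : B} (ha : 0 ≤ a) (hb : 0 ≤ b) {ε : ℝ}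
    (hε : 0 < ε) (hx : ‖star x * b * x - a‖ ≤ ε / 6)
    (hinv : ∀ r s : B, r * x * s ∈ closure {w : B | IsUnit w}) :
    ∃ u ∈ unitary B, u * cfc (fun t : ℝ => max (t - ε) 0) a * star u ∈
      closure {w | ∃ r s : B, w = b * (r * x * s) * b} := by
  obtain ⟨δ, hδ, rfl⟩ : ∃ δ : ℝ, 0 < δ ∧ ε = 6 * δ := ⟨ε / 6, by positivity, by ring⟩
  replace hx : ‖star x * b * x - a‖ ≤ δ := by linarith
  have has : IsSelfAdjoint a := .of_nonneg ha
  set β := cfc Real.sqrt b with hβ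
  have hβs : star β = β := (cfc_predicate Real.sqrt b : IsSelfAdjoint _).star_eq
  have hββ : β * β = b := by
    rw [hβ, ← cfc_mul _ _ b (by fun_prop) (by fun_prop)]
    conv_rhs => rw [← cfc_id' ℝ b]
    exact cfc_congr fun t ht => Real.mul_self_sqrt (spectrum_nonneg_of_nonneg hb ht)
  let g : ℝ → ℝ := fun t => √(ramp δ (2 * δ) t / max (t - δ) δ)
  have hgc : Continuous g := by
    have := continuous_ramp δ (2 * δ)
    refine Continuous.sqrt (Continuous.div this (by fun_prop) fun t => ?_)
    exact (lt_max_of_lt_right hδ).ne'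
  have hg : ∀ t, g t * (t - δ) * g t = ramp δ (2 * δ) t := by
    intro t
    have hmax : 0 < max (t - δ) δ := lt_max_of_lt_right hδ
    rw [mul_comm (g t), mul_assoc, Real.mul_self_sqrt (div_nonneg (ramp_nonneg _ _ _) hmax.le)]
    rcases le_total t (2 * δ) with h | h
    · simp [ramp_of_le hδ h]
    · have h1 : δ ≤ t - δ := by linarith
      rw [max_eq_left h1, mul_div_cancel₀]
      linarith
  set G := cfc g a with hG
  have hGs : star G = G := (cfc_predicate g a : IsSelfAdjoint _).star_eq
  have hle : a - algebraMap ℝ B δ ≤ star x * b * x := by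
    have hsa : IsSelfAdjoint (a - star x * b * x) := has.sub <| by
      simp [isSelfAdjoint_iff, mul_assoc, (IsSelfAdjoint.of_nonneg hb).star_eq]
    have h1 : a - star x * b * x ≤ algebraMap ℝ B δ :=
      hsa.le_algebraMap_norm_self.trans <| algebraMap_mono B (by rwa [norm_sub_rev])
    exact sub_le_comm.mp h1
  have hm : cfc (ramp δ (2 * δ)) a ≤ star (β * x * G) * (β * x * G) := by
    have h1 : cfc (ramp δ (2 * δ)) a = star G * (a - algebraMap ℝ B δ) * G := by
      rw [← funext hg, cfc_mul _ _ a (by fun_prop) (by fun_prop),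
        cfc_mul _ _ a (by fun_prop) (by fun_prop), cfc_sub _ _ a (by fun_prop) (by fun_prop),
        cfc_id' ℝ a, cfc_const δ a, hGs]
    have h2 : star (β * x * G) * (β * x * G) = star G * (star x * b * x) * G := by
      rw [star_mul, star_mul, hβs, ← hββ]
      noncomm_ring
    rw [h1, h2]
    exact star_left_conjugate_le_conjugate hle G
  obtain ⟨z, hz, hzm⟩ := exists_star_mul_self_eq_of_le
    (cfc_nonneg fun t _ => ramp_nonneg δ (2 * δ) t) hm
  have hzinv : z ∈ closure {w : B | IsUnit w} := by
    refine closure_minimal ?_ isClosed_closure hz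
    rintro _ ⟨r, rfl⟩
    simpa only [mul_assoc] using hinv β (G * r)
  set k := cfc (fun t : ℝ => max (t - 6 * δ) 0) a with hk
  have hks : IsSelfAdjoint k := cfc_predicate _ a
  have hsucc : ∀ n : ℝ, cfc (ramp δ (n * δ)) a * cfc (ramp δ ((n + 1) * δ)) a =
      cfc (ramp δ ((n + 1) * δ)) a := fun n =>
    cfc_ramp_mul_cfc hδ a (continuous_ramp _ _) fun t ht => ramp_of_le hδ (by linarith)
  obtain ⟨u, hu, huz⟩ := exists_unitary_mul_eq_of_mem_closure (z := z)
    (e := cfc (ramp δ (3 * δ)) a) (f := cfc (ramp δ (4 * δ)) a) (g := cfc (ramp δ (5 * δ)) a)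
    hzinv (by rw [hzm]; convert hsucc 2 using 5 <;> norm_num)
    (cfc_predicate _ a) (cfc_predicate _ a) (cfc_predicate _ a)
    (by convert hsucc 3 using 5 <;> norm_num) (by convert hsucc 4 using 5 <;> norm_num)
  have hfk : cfc (ramp δ (5 * δ)) a * k = k :=
    cfc_ramp_mul_cfc hδ a (by fun_prop) fun t ht => max_eq_right (by linarith)
  have huk : u * k = z * k := by rw [← hfk, ← mul_assoc, huz, mul_assoc]
  have huku : u * k * star u = z * k * star z := by
    have : k * star u = k * star z := by simpa [hks.star_eq] using congrArg star huk
    rw [huk, mul_assoc, this, mul_assoc]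
  refine ⟨u, hu, ?_⟩
  rw [huku]
  have hmap : Set.MapsTo (fun w => w * k * star w) (Set.range fun r => β * x * G * r)
      (closure {w | ∃ r s : B, w = b * (r * x * s) * b}) := by
    rintro _ ⟨r, rfl⟩
    have h2 := cfc_sqrt_mul_mul_mem_closure hb (x * (G * r * k * star (x * G * r)))
    have h3 : β * x * G * r * k * star (β * x * G * r) =
        β * (x * (G * r * k * star (x * G * r))) * β := by
      simp only [star_mul, hβs, mul_assoc]
    simp only [h3]
    refine closure_mono ?_ h2
    rintro _ ⟨r', s', rfl⟩
    exact ⟨r', G * r * k * star (x * G * r) * s', by simp only [mul_assoc]⟩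
  have := hmap.closure (by fun_prop) hz
  rwa [closure_closure] at this

/-- If `d²` is unitarily conjugate to an element of the hereditary subalgebra generated by `b`,
then `d²` is approximated by elements `star (r * d) * b * (r * d)`. -/
theorem exists_norm_star_mul_mul_sub_lt {b d u : B} (hb : 0 ≤ b) (hd : IsSelfAdjoint d)
    (hu : u ∈ unitary B) (hc : u * (d * d) * star u ∈ closure {w | ∃ y : B, w = b * y * b})
    {η : ℝ} (hη : 0 < η) : ∃ r : B, ‖star (r * d) * b * (r * d) - d * d‖ < η := by
  set c := u * (d * d) * star u with hcdef
  set v := u * d with hv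
  have hvv : v * star v = c := by
    rw [hv, star_mul, hd.star_eq, hcdef]; noncomm_ring
  have hvv' : star v * v = d * d := by
    rw [hv, star_mul, hd.star_eq, mul_assoc, ← mul_assoc (star u), (Unitary.mem_iff.mp hu).1,
      one_mul]
  set κ := η ^ 2 / (‖v‖ * ‖v‖ + 1) with hκdef
  have hκ : 0 < κ := by positivity
  obtain ⟨_, ⟨y, rfl⟩, hy⟩ := Metric.mem_closure_iff.mp hc (κ / 2) (by positivity)
  rw [dist_eq_norm] at hy
  set s := κ / 2 / (‖y * b‖ + 1) with hsdef
  have hs : 0 < s := by positivity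
  have hcs := continuous_truncInvSqrt hs
  set p := cfc (truncInvSqrt s) b with hp
  have hps : star p = p := (cfc_predicate _ b : IsSelfAdjoint _).star_eq
  set w := cfc (fun t => 1 - t * (truncInvSqrt s t * truncInvSqrt s t)) b with hw
  have hws : star w = w := (cfc_predicate _ b : IsSelfAdjoint _).star_eq
  have hwp : w = 1 - p * b * p := by
    have hcomm : p * b = b * p := ((Commute.refl b).cfc_real _).eq
    rw [hcomm, hw, cfc_sub _ _ b (by fun_prop) (by fun_prop), cfc_const_one ℝ b,
      cfc_mul _ _ b (by fun_prop) (by fun_prop), cfc_mul _ _ b (by fun_prop) (by fun_prop),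
      cfc_id' ℝ b, mul_assoc]
  have hw1 : ‖w‖ ≤ 1 := norm_cfc_le zero_le_one fun t ht => by
    have := mul_truncInvSqrt_sq_mem hs (spectrum_nonneg_of_nonneg hb ht)
    rw [Real.norm_eq_abs, abs_le]
    constructor <;> linarith [this.1, this.2]
  have hwb : ‖w * b‖ ≤ s := by
    have : w * b = cfc (fun t => (1 - t * (truncInvSqrt s t * truncInvSqrt s t)) * t) b := by
      rw [cfc_mul _ _ b (by fun_prop) (by fun_prop), cfc_id' ℝ b]
    rw [this]
    refine norm_cfc_le hs.le fun t ht => ?_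
    have ht0 : 0 ≤ t := spectrum_nonneg_of_nonneg hb ht
    have := mul_truncInvSqrt_sq_mem hs ht0
    rw [mul_comm, Real.norm_of_nonneg (mul_nonneg ht0 (sub_nonneg.mpr this.2))]
    exact mul_one_sub_truncInvSqrt_sq_le hs ht0
  have hwc : ‖w * c‖ < κ := by
    calc ‖w * c‖ = ‖w * (c - b * y * b) + w * b * (y * b)‖ := by congr 1; noncomm_ring
      _ ≤ ‖w‖ * ‖c - b * y * b‖ + ‖w * b‖ * ‖y * b‖ :=
        (norm_add_le _ _).trans (add_le_add (norm_mul_le _ _) (norm_mul_le _ _))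
      _ ≤ 1 * ‖c - b * y * b‖ + s * ‖y * b‖ := by gcongr
      _ < κ / 2 + κ / 2 := by
        have h1 : s * ‖y * b‖ ≤ κ / 2 := by
          rw [hsdef, div_mul_eq_mul_div, div_le_iff₀ (by positivity)]
          gcongr
          linarith
        linarith
      _ = κ := by ring
  refine ⟨p * u, ?_⟩
  have h1 : star (p * u * d) * b * (p * u * d) - d * d = -(star v * w * v) := by
    rw [mul_assoc p, ← hv, star_mul, hps, ← hvv', hwp]
    noncomm_ring
  rw [h1, norm_neg, ← sq_lt_sq₀ (norm_nonneg _) hη.le, sq, ← CStarRing.norm_star_mul_self]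
  calc ‖star (star v * w * v) * (star v * w * v)‖ = ‖star v * w * (v * star v) * w * v‖ := by
        rw [star_mul (star v * w), star_mul (star v) w, star_star, hws]; congr 1; noncomm_ring
    _ = ‖star v * (w * c) * (w * v)‖ := by rw [hvv]; congr 1; noncomm_ring
    _ ≤ ‖star v‖ * ‖w * c‖ * (‖w‖ * ‖v‖) :=
        (norm_mul_le _ _).trans (mul_le_mul (norm_mul_le _ _) (norm_mul_le _ _)
          (norm_nonneg _) (by positivity))
    _ ≤ ‖v‖ * κ * (1 * ‖v‖) := by
        rw [norm_star]
        gcongr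
    _ < η ^ 2 := by
        have : ‖v‖ * κ * (1 * ‖v‖) = η ^ 2 * (‖v‖ * ‖v‖) / (‖v‖ * ‖v‖ + 1) := by
          rw [hκdef]; ring
        rw [this, div_lt_iff₀ (by positivity)]
        have : 0 < η ^ 2 := by positivity
        linarith

end CStarAlgebra

theorem Unitization.exists_inr_eq_mul_mul {A : Type*} [NonUnitalCStarAlgebra A]
    (r : Unitization ℂ A) (x : A) (s : Unitization ℂ A) :
    ∃ y : A, (y : Unitization ℂ A) = r * x * s := by
  refine ⟨(r * x * s).snd, Unitization.ext ?_ (by simp)⟩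
  simp

open Filter in
/-- Let `A` be a C*-algebra with dense invertibles and let `a, b` be positive
elements of `A`.  Then `a` is Cuntz smaller than `b` if and only if for every `ε > 0` there is
a unitary `u` of `A~ = Unitization ℂ A` such that `u (a - ε)₊ u*` lies in the hereditary
C*-subalgebra `closure (b A b)` of `A` (here `(a - ε)₊ = cfcₙ (fun t => max (t - ε) 0) a`). -/
theorem stmt5 {A : Type*} [NonUnitalCStarAlgebra A] [PartialOrder A] [StarOrderedRing A]
    (hA : ∀ x : A, (x : Unitization ℂ A) ∈ closure {z : Unitization ℂ A | IsUnit z})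
    (a b : A) (ha : 0 ≤ a) (hb : 0 ≤ b) :
    (∃ x : ℕ → A, Tendsto (fun n => ‖star (x n) * b * x n - a‖) atTop (nhds 0)) ↔
      (∀ ε : ℝ, 0 < ε → ∃ u ∈ unitary (Unitization ℂ A),
        ∃ c ∈ closure {z : A | ∃ y : A, z = b * y * b},
          u * (cfcₙ (fun t : ℝ => max (t - ε) 0) a : Unitization ℂ A) * star u
            = (c : Unitization ℂ A)) := by
  have ha' : (0 : Unitization ℂ A) ≤ a := Unitization.inr_nonneg_iff.mpr ha
  have hb' : (0 : Unitization ℂ A) ≤ b := Unitization.inr_nonneg_iff.mpr hb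
  have hiso : Isometry (Unitization.inr : A → Unitization ℂ A) := Unitization.isometry_inr
  have hcfc : ∀ ε : ℝ, 0 < ε → cfcₙ (fun t : ℝ => max (t - ε) 0) (a : Unitization ℂ A) =
      cfc (fun t : ℝ => max (t - ε) 0) (a : Unitization ℂ A) := fun ε hε =>
    cfcₙ_eq_cfc (by fun_prop) (by simp [hε.le])
  have hinr : ∀ ε : ℝ, 0 < ε → ((cfcₙ (fun t : ℝ => max (t - ε) 0) a : A) : Unitization ℂ A) =
      cfc (fun t : ℝ => max (t - ε) 0) (a : Unitization ℂ A) := fun ε hε =>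
    Unitization.real_cfcₙ_eq_cfc_inr a _ (by simp [hε.le])
  constructor
  · rintro ⟨x, hx⟩ ε hε
    obtain ⟨n, hn⟩ := (hx.eventually_lt_const (show (0 : ℝ) < ε / 6 by positivity)).exists
    have hn' : ‖star (x n : Unitization ℂ A) * b * x n - a‖ ≤ ε / 6 := by
      have h1 : star (x n : Unitization ℂ A) * b * x n - a =
          ((star (x n) * b * x n - a : A) : Unitization ℂ A) := by simp
      rw [h1, Unitization.norm_inr]
      exact hn.le
    obtain ⟨u, hu, huc⟩ := exists_unitary_conj_mem_closure ha' hb' hε hn' fun r s => by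
      obtain ⟨y, hy⟩ := Unitization.exists_inr_eq_mul_mul r (x n) s
      rw [← hy]
      exact hA y
    rw [← hinr ε hε] at huc
    obtain ⟨c, hc⟩ := Unitization.exists_inr_eq_mul_mul u (cfcₙ (fun t : ℝ => max (t - ε) 0) a)
      (star u)
    refine ⟨u, hu, c, ?_, by rw [hcfc ε hε, ← hinr ε hε, hc]⟩
    rw [hiso.isEmbedding.isInducing.closure_eq_preimage_closure_image, Set.mem_preimage, hc]
    refine closure_mono ?_ huc
    rintro _ ⟨r, s, rfl⟩
    obtain ⟨y, hy⟩ := Unitization.exists_inr_eq_mul_mul r (x n) s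
    exact ⟨b * y * b, ⟨y, rfl⟩, by rw [← hy]; simp⟩
  · intro h
    have key : ∀ ε : ℝ, 0 < ε → ∃ x : A, ‖star x * b * x - a‖ < 2 * ε := by
      intro ε hε
      obtain ⟨u, hu, c, hc, huc⟩ := h ε hε
      rw [hcfc ε hε, ← hinr ε hε] at huc
      have hk0 : 0 ≤ cfcₙ (fun t : ℝ => max (t - ε) 0) a :=
        cfcₙ_nonneg fun t _ => le_max_right _ _
      have hd : IsSelfAdjoint (CFC.sqrt (cfcₙ (fun t : ℝ => max (t - ε) 0) a)) :=
        .of_nonneg (CFC.sqrt_nonneg _)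
      have hdd := CFC.sqrt_mul_sqrt_self _ hk0
      set d := CFC.sqrt (cfcₙ (fun t : ℝ => max (t - ε) 0) a) with hddef
      have hdd' : (d : Unitization ℂ A) * d =
          cfc (fun t : ℝ => max (t - ε) 0) (a : Unitization ℂ A) := by
        rw [← hinr ε hε, ← hdd, Unitization.inr_mul]
      obtain ⟨r, hr⟩ := exists_norm_star_mul_mul_sub_lt hb' (d := (d : Unitization ℂ A))
        (Unitization.isSelfAdjoint_inr.mpr hd) hu (by
          rw [hdd', ← hinr ε hε, huc]
          rw [hiso.isEmbedding.isInducing.closure_eq_preimage_closure_image,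
            Set.mem_preimage] at hc
          refine closure_mono ?_ hc
          rintro _ ⟨_, ⟨y, rfl⟩, rfl⟩
          exact ⟨y, by simp⟩) hε
      obtain ⟨x, hx⟩ := Unitization.exists_inr_eq_mul_mul r d 1
      rw [mul_one] at hx
      refine ⟨x, ?_⟩
      have hka : ‖(d : Unitization ℂ A) * d - a‖ ≤ ε := by
        have h1 : (d : Unitization ℂ A) * d - a =
            cfc (fun t : ℝ => max (t - ε) 0 - t) (a : Unitization ℂ A) := by
          rw [hdd', cfc_sub _ _ _ (by fun_prop) (by fun_prop), cfc_id' ℝ (a : Unitization ℂ A)]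
        rw [h1]
        refine norm_cfc_le hε.le fun t ht => ?_
        have ht0 : 0 ≤ t := spectrum_nonneg_of_nonneg ha' ht
        rw [Real.norm_eq_abs, abs_le]
        rcases max_cases (t - ε) 0 with h | h <;> constructor <;> linarith
      rw [← Unitization.norm_inr (𝕜 := ℂ)]
      calc ‖((star x * b * x - a : A) : Unitization ℂ A)‖
          = ‖(star (r * d) * b * (r * d) - d * d) + ((d : Unitization ℂ A) * d - a)‖ := by
            rw [← hx]; simp
        _ ≤ _ := norm_add_le _ _
        _ < 2 * ε := by linarith
    choose x hx using fun n : ℕ => key (1 / ((n : ℝ) + 1)) (by positivity)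
    refine ⟨x, squeeze_zero (fun _ => norm_nonneg _) (fun n => (hx n).le) ?_⟩
    simpa using tendsto_one_div_add_atTop_nhds_zero_nat (𝕜 := ℝ).const_mul 2
end

section
/- Let D be a C*-algebra, φ : D → D a *-homomorphism, ω an ultrafilter on ℕ, and (v_n)_{n∈ℕ} a sequence of invertible elements of D~ = Unitization ℂ D with sup_n ‖v_n‖ < ∞. Assume that for every x ∈ D (viewed inside D~): ‖v_n x − φ(x) v_n‖ → 0 along ω, ‖v_n* v_n x − x‖ → 0 along ω, and ‖v_n v_n* φ(x) − φ(x)‖ → 0 along ω. For each n set u_n := v_n (v_n* v_n)^{−1/2}, where (v_n* v_n)^{−1/2} is defined by continuous functional calculus. Then each u_n is a unitary element of D~, and for every x ∈ D one has ‖u_n x u_n* − φ(x)‖ → 0 along ω. -/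
section PolarDecomposition

variable {A : Type*} [CStarAlgebra A]

lemma pos_of_mem_spectrum_star_mul_self {v : A} (hv : IsUnit v) {t : ℝ}
    (ht : t ∈ spectrum ℝ (star v * v)) : 0 < t := by
  refine lt_of_le_of_ne (spectrum_star_mul_self_nonneg t ht) ?_
  rintro rfl
  exact spectrum.zero_notMem ℝ (hv.star.mul hv) ht

lemma continuousOn_inv_sqrt_spectrum_star_mul_self {v : A} (hv : IsUnit v) :
    ContinuousOn (fun t : ℝ => (Real.sqrt t)⁻¹) (spectrum ℝ (star v * v)) :=
  Real.continuous_sqrt.continuousOn.inv₀ fun _ ht =>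
    (Real.sqrt_pos.2 (pos_of_mem_spectrum_star_mul_self hv ht)).ne'

lemma continuousOn_inv_one_add_sqrt (s : Set ℝ) :
    ContinuousOn (fun t : ℝ => (1 + Real.sqrt t)⁻¹) s :=
  (continuousOn_const.add Real.continuous_sqrt.continuousOn).inv₀ fun t _ =>
    (add_pos_of_pos_of_nonneg one_pos (Real.sqrt_nonneg t)).ne'

lemma inv_sqrt_mul_sqrt_star_mul_self {v : A} (hv : IsUnit v) :
    cfc (fun t : ℝ => (Real.sqrt t)⁻¹) (star v * v) * cfc Real.sqrt (star v * v) = 1 := by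
  rw [← cfc_mul _ _ _ (continuousOn_inv_sqrt_spectrum_star_mul_self hv)
    Real.continuous_sqrt.continuousOn, ← cfc_const_one ℝ (star v * v)]
  refine cfc_congr fun t ht => ?_
  exact inv_mul_cancel₀ (Real.sqrt_pos.2 (pos_of_mem_spectrum_star_mul_self hv ht)).ne'

lemma sqrt_mul_sqrt_star_mul_self (v : A) :
    cfc Real.sqrt (star v * v) * cfc Real.sqrt (star v * v) = star v * v := by
  rw [← cfc_mul _ _ _ Real.continuous_sqrt.continuousOn Real.continuous_sqrt.continuousOn]
  conv_rhs => rw [← cfc_id ℝ (star v * v)]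
  refine cfc_congr fun t ht => ?_
  exact Real.mul_self_sqrt (spectrum_star_mul_self_nonneg t ht)

/-- The functional calculus form of `√t - 1 = (t - 1) / (1 + √t)`. -/
lemma sqrt_star_mul_self_sub_one (v : A) :
    cfc Real.sqrt (star v * v) - 1 =
      (star v * v - 1) * cfc (fun t : ℝ => (1 + Real.sqrt t)⁻¹) (star v * v) := by
  have hs := sqrt_mul_sqrt_star_mul_self v
  have hc : (1 + cfc Real.sqrt (star v * v)) *
      cfc (fun t : ℝ => (1 + Real.sqrt t)⁻¹) (star v * v) = 1 := by
    rw [← cfc_const_one ℝ (star v * v), ← cfc_add _ _ _ continuousOn_const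
      Real.continuous_sqrt.continuousOn, ← cfc_mul (fun t : ℝ => 1 + Real.sqrt t) _ _
      (continuousOn_const.add Real.continuous_sqrt.continuousOn) (continuousOn_inv_one_add_sqrt _)]
    refine cfc_congr fun t _ => ?_
    have := Real.sqrt_nonneg t
    exact mul_inv_cancel₀ (by positivity)
  generalize cfc Real.sqrt (star v * v) = s at *
  calc s - 1 = (s - 1) * ((1 + s) * _) := by rw [hc, mul_one]
    _ = (s * s - 1) * _ := by noncomm_ring
    _ = _ := by rw [hs]

lemma norm_inv_one_add_sqrt_star_mul_self_le (v : A) :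
    ‖cfc (fun t : ℝ => (1 + Real.sqrt t)⁻¹) (star v * v)‖ ≤ 1 := by
  refine norm_cfc_le zero_le_one fun t _ => ?_
  have := Real.sqrt_nonneg t
  rw [Real.norm_of_nonneg (by positivity)]
  exact inv_le_one_of_one_le₀ (by linarith)

lemma mul_inv_sqrt_star_mul_self_mem_unitary {v : A} (hv : IsUnit v) :
    v * cfc (fun t : ℝ => (Real.sqrt t)⁻¹) (star v * v) ∈ unitary A := by
  have hrs := inv_sqrt_mul_sqrt_star_mul_self hv
  have hsr := hrs
  rw [cfc_commute_cfc] at hsr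
  have hss := sqrt_mul_sqrt_star_mul_self v
  have hr : star (cfc (fun t : ℝ => (Real.sqrt t)⁻¹) (star v * v)) =
    cfc (fun t : ℝ => (Real.sqrt t)⁻¹) (star v * v) := (cfc_predicate _ _ : IsSelfAdjoint _)
  have hru : IsUnit (cfc (fun t : ℝ => (Real.sqrt t)⁻¹) (star v * v)) := ⟨⟨_, _, hrs, hsr⟩, rfl⟩
  generalize cfc (fun t : ℝ => (Real.sqrt t)⁻¹) (star v * v) = r at *
  generalize cfc Real.sqrt (star v * v) = s at *
  have hu : star (v * r) * (v * r) = 1 := by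
    calc star (v * r) * (v * r) = r * (star v * v) * r := by rw [star_mul, hr]; noncomm_ring
      _ = (r * s) * (s * r) := by rw [← hss]; noncomm_ring
      _ = 1 := by rw [hrs, hsr, one_mul]
  refine Unitary.mem_iff.2 ⟨hu, (hv.mul hru).mul_left_inj.1 ?_⟩
  rw [mul_assoc, hu, mul_one, one_mul]

/-- The unitary part `u` of an invertible `v` intertwines `x` and `y` up to the errors with which
`v` intertwines them and acts isometrically on `x` and coisometrically on `y`. -/
lemma norm_polar_conj_sub_le {v : A} (hv : IsUnit v) (x y : A) :
    ‖v * cfc (fun t : ℝ => (Real.sqrt t)⁻¹) (star v * v) * x *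
        star (v * cfc (fun t : ℝ => (Real.sqrt t)⁻¹) (star v * v)) - y‖ ≤
      ‖star v * v * x - x‖ + ‖v * x - y * v‖ + ‖v * star v * star y - star y‖ := by
  have hu := mul_inv_sqrt_star_mul_self_mem_unitary hv
  have hrs := inv_sqrt_mul_sqrt_star_mul_self hv
  have hss := sqrt_mul_sqrt_star_mul_self v
  have hs1 := sqrt_star_mul_self_sub_one v
  have hc := norm_inv_one_add_sqrt_star_mul_self_le v
  have hsa : star (cfc Real.sqrt (star v * v)) = cfc Real.sqrt (star v * v) :=
    (cfc_predicate _ _ : IsSelfAdjoint _)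
  have hca : star (cfc (fun t : ℝ => (1 + Real.sqrt t)⁻¹) (star v * v)) =
    cfc (fun t : ℝ => (1 + Real.sqrt t)⁻¹) (star v * v) := (cfc_predicate _ _ : IsSelfAdjoint _)
  generalize cfc (fun t : ℝ => (1 + Real.sqrt t)⁻¹) (star v * v) = c at *
  generalize cfc Real.sqrt (star v * v) = s at *
  have hus : v * cfc (fun t : ℝ => (Real.sqrt t)⁻¹) (star v * v) * s = v := by
    rw [mul_assoc, hrs, mul_one]
  generalize v * cfc (fun t : ℝ => (Real.sqrt t)⁻¹) (star v * v) = u at *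
  have huu := Unitary.mul_star_self_of_mem hu
  have hs1' : s - 1 = c * (star v * v - 1) := by
    simpa [hsa, hca] using congrArg star hs1
  have hvv : v * star v = u * (star v * v) * star u := by
    calc v * star v = (u * s) * star (u * s) := by rw [hus]
      _ = u * (s * s) * star u := by rw [star_mul, hsa]; noncomm_ring
      _ = _ := by rw [hss]
  have hy : ‖v * star v * star y - star y‖ = ‖y * (u * (star v * v - 1) * star u)‖ := by
    rw [← norm_star]
    congr 1
    rw [mul_sub u, sub_mul, ← hvv, mul_one, huu]
    simp [mul_sub, mul_assoc]
  have hus' := Unitary.star_mem hu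
  have key : u * x * star u - y = -(u * (c * (star v * v * x - x)) * star u) +
      (v * x - y * v) * star u + y * (u * (star v * v - 1) * star u) * (u * c * star u) := by
    have e1 : c * (star v * v * x - x) = s * x - x := by
      rw [← one_mul x, ← mul_assoc, mul_one, ← sub_mul, ← mul_assoc, ← hs1', sub_mul, one_mul]
    have e2 : y * (u * (star v * v - 1) * star u) * (u * c * star u) = y * v * star u - y := by
      calc _ = y * (u * ((star v * v - 1) * (star u * u) * c) * star u) := by noncomm_ring
        _ = y * (u * s) * star u - y * (u * star u) := by
          rw [Unitary.star_mul_self_of_mem hu, mul_one, ← hs1]; noncomm_ring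
        _ = _ := by rw [hus, huu, mul_one]
    have e3 : u * (s * x - x) * star u = v * x * star u - u * x * star u := by
      rw [mul_sub, ← mul_assoc, hus, sub_mul]
    rw [e1, e2, e3]
    noncomm_ring
  have n1 : ‖u * (c * (star v * v * x - x)) * star u‖ ≤ ‖star v * v * x - x‖ := by
    rw [CStarRing.norm_mul_mem_unitary _ hus', CStarRing.norm_mem_unitary_mul _ hu]
    exact (norm_mul_le _ _).trans (mul_le_of_le_one_left (norm_nonneg _) hc)
  have n2 : ‖y * (u * (star v * v - 1) * star u) * (u * c * star u)‖ ≤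
      ‖v * star v * star y - star y‖ := by
    rw [hy]
    refine (norm_mul_le _ _).trans (mul_le_of_le_one_right (norm_nonneg _) ?_)
    rwa [CStarRing.norm_mul_mem_unitary _ hus', CStarRing.norm_mem_unitary_mul _ hu]
  rw [key]
  refine (norm_add₃_le).trans ?_
  rw [norm_neg, CStarRing.norm_mul_mem_unitary (v * x - y * v) hus']
  gcongr

end PolarDecomposition

open Filter in
/-- Let `D` be a C*-algebra, `φ : D → D` a *-homomorphism, `ω` an ultrafilter
on `ℕ`, and `(vₙ)` a bounded sequence of invertible elements of `D~ = Unitization ℂ D` such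
that, along `ω`, `vₙ x - φ(x) vₙ → 0`, `vₙ* vₙ x - x → 0` and `vₙ vₙ* φ(x) - φ(x) → 0` for
every `x ∈ D`.  Then each `uₙ := vₙ (vₙ* vₙ)^{-1/2}` is a unitary of `D~` and
`uₙ x uₙ* - φ(x) → 0` along `ω` for every `x ∈ D`. -/
theorem stmt7 {D : Type*} [NonUnitalCStarAlgebra D] (φ : D →⋆ₙₐ[ℂ] D)
    (ω : Ultrafilter ℕ) (v : ℕ → Unitization ℂ D)
    (hvinv : ∀ n, IsUnit (v n)) (hvbdd : ∃ M : ℝ, ∀ n, ‖v n‖ ≤ M)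
    (h1 : ∀ x : D, Tendsto
      (fun n => ‖v n * (x : Unitization ℂ D) - (φ x : Unitization ℂ D) * v n‖) ↑ω (nhds 0))
    (h2 : ∀ x : D, Tendsto
      (fun n => ‖star (v n) * v n * (x : Unitization ℂ D) - (x : Unitization ℂ D)‖) ↑ω (nhds 0))
    (h3 : ∀ x : D, Tendsto
      (fun n => ‖v n * star (v n) * (φ x : Unitization ℂ D) - (φ x : Unitization ℂ D)‖)
      ↑ω (nhds 0)) :
    (∀ n, v n * cfc (fun t : ℝ => (Real.sqrt t)⁻¹) (star (v n) * v n)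
        ∈ unitary (Unitization ℂ D)) ∧
    ∀ x : D, Tendsto
      (fun n => ‖(v n * cfc (fun t : ℝ => (Real.sqrt t)⁻¹) (star (v n) * v n))
          * (x : Unitization ℂ D)
          * star (v n * cfc (fun t : ℝ => (Real.sqrt t)⁻¹) (star (v n) * v n))
        - (φ x : Unitization ℂ D)‖) ↑ω (nhds 0) := by
  refine ⟨fun n => mul_inv_sqrt_star_mul_self_mem_unitary (hvinv n), fun x => ?_⟩
  refine squeeze_zero (fun _ => norm_nonneg _)
    (fun n => norm_polar_conj_sub_le (hvinv n) (x : Unitization ℂ D) (φ x)) ?_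
  have h := ((h2 x).add (h1 x)).add (h3 (star x))
  simpa only [add_zero, map_star, Unitization.inr_star] using h
end
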